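/- For every i with 1 ≤ i ≤ N−1, every partition λ = (λ_1 ≥ … ≥ λ_i ≥ 0) with λ_{i+1} = … = λ_{N−1} = 0, and every subset J ⊆ {1,…,N} with |J| = i+1, one has Ñ_{i+1,J} φ_λ = 0. -/

import Mathlib

open MvPolynomial Finset

section CSDefs

variable {F : Type*} [Field F] [CharZero F]

/-- Exact division in a polynomial ring: `divExact d f = f / d` when `d ∣ f`, junk otherwise. -/
noncomputable def divExact {σ : Type*} (d f : MvPolynomial σ F) : MvPolynomial σ F := by
  classical exact if h : ∃ c, f = d * c then h.choose else 0

/-- The exchange operator `K_{ij}` permuting the variables `z_i` and `z_j`. -/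
noncomputable def Kswap {N : ℕ} (i j : Fin N) (f : MvPolynomial (Fin N) F) :
    MvPolynomial (Fin N) F :=
  rename (Equiv.swap i j) f

/-- The Dunkl operator `∇_i = ∂_i + β ∑_{j ≠ i} (z_i - z_j)⁻¹ (1 - K_{ij})`. -/
noncomputable def nabla {N : ℕ} (β : F) (i : Fin N) (f : MvPolynomial (Fin N) F) :
    MvPolynomial (Fin N) F :=
  pderiv i f + β • ∑ j ∈ Finset.univ.erase i, divExact (X i - X j) (f - Kswap i j f)

/-- `D_i = z_i ∇_i`. -/
noncomputable def Dop {N : ℕ} (β : F) (i : Fin N) (f : MvPolynomial (Fin N) F) :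
    MvPolynomial (Fin N) F :=
  X i * nabla β i f

/-- `(D_{j₁} + kβ)(D_{j₂} + (k+1)β) ⋯` applied along a list of indices. -/
noncomputable def Dlist {N : ℕ} (β : F) :
    ℕ → List (Fin N) → MvPolynomial (Fin N) F → MvPolynomial (Fin N) F
  | _, [], f => f
  | k, j :: rest, f => Dop β j (Dlist β (k + 1) rest f) + ((k : F) * β) • Dlist β (k + 1) rest f

/-- `D_{k,J} = (D_{j₁} + kβ)(D_{j₂} + (k+1)β) ⋯ (D_{j_ℓ} + (k+ℓ-1)β)` for
`J = {j₁ < j₂ < … < j_ℓ}`. -/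
noncomputable def DJ {N : ℕ} (β : F) (k : ℕ) (J : Finset (Fin N))
    (f : MvPolynomial (Fin N) F) : MvPolynomial (Fin N) F :=
  Dlist β k (J.sort (· ≤ ·)) f

/-- `z_J = ∏_{i ∈ J} z_i`. -/
noncomputable def zJ {N : ℕ} (J : Finset (Fin N)) : MvPolynomial (Fin N) F := ∏ i ∈ J, X i

/-- The creation operator `B⁺_{i,J} = ∑_{J' ⊆ J, |J'| = i} z_{J'} D_{1,J'}`. -/
noncomputable def Bplus {N : ℕ} (β : F) (i : ℕ) (J : Finset (Fin N))
    (f : MvPolynomial (Fin N) F) : MvPolynomial (Fin N) F :=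
  ∑ J' ∈ J.powersetCard i, zJ J' * DJ β 1 J' f

/-- `A_{ij} = ((z_i+z_j)/(z_i-z_j))(z_i ∂_i - z_j ∂_j)`. -/
noncomputable def Aop {N : ℕ} (i j : Fin N) (f : MvPolynomial (Fin N) F) :
    MvPolynomial (Fin N) F :=
  divExact (X i - X j) ((X i + X j) * (X i * pderiv i f - X j * pderiv j f))

/-- `H^{(S)} = ∑_{i ∈ S} (z_i ∂_i)² + β ∑_{i<j, i,j ∈ S} A_{ij}`. -/
noncomputable def Hop {N : ℕ} (β : F) (S : Finset (Fin N)) (f : MvPolynomial (Fin N) F) :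
    MvPolynomial (Fin N) F :=
  ∑ i ∈ S, X i * pderiv i (X i * pderiv i f)
    + β • ∑ i ∈ S, ∑ j ∈ S.filter (fun j => i < j), Aop i j f

/-- A polynomial is symmetric in the variables indexed by `S`. -/
def SymmOn {N : ℕ} (S : Finset (Fin N)) (f : MvPolynomial (Fin N) F) : Prop :=
  ∀ i ∈ S, ∀ j ∈ S, rename (Equiv.swap i j) f = f

/-- `phiCS β N lam i = (B⁺_i)^{λ_i - λ_{i+1}} ⋯ (B⁺_1)^{λ_1 - λ_2} · 1`,
where `lam` is 0-indexed: `lam (j-1) = λ_j`. -/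
noncomputable def phiCS (β : F) (N : ℕ) (lam : ℕ → ℕ) : ℕ → MvPolynomial (Fin N) F
  | 0 => 1
  | i + 1 => (fun f => Bplus β (i + 1) Finset.univ f)^[lam i - lam (i + 1)] (phiCS β N lam i)

/-- The monomial symmetric polynomial attached to an exponent vector. -/
noncomputable def msym (N : ℕ) (lam : Fin N → ℕ) : MvPolynomial (Fin N) F := by
  classical
  exact ∑ v ∈ (Finset.univ : Finset (Equiv.Perm (Fin N))).image
      (fun σ => fun i => lam (σ i)), ∏ i, X i ^ v i

/-- `𝐷̂_i = D_i + β(i-1) - β ∑_{j<i} (1 - K_{ij})` (0-indexed: `i-1` becomes `i`). -/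
noncomputable def Dhat {N : ℕ} (β : F) (i : Fin N) (f : MvPolynomial (Fin N) F) :
    MvPolynomial (Fin N) F :=
  Dop β i f + (β * ((i : ℕ) : F)) • f
    - β • ∑ j ∈ Finset.univ.filter (fun j => j < i), (f - Kswap i j f)

end CSDefs

section DunklOperators

variable {F : Type*} [Field F] {N : ℕ}

theorem mul_divExact {σ : Type*} {d f : MvPolynomial σ F} (h : d ∣ f) :
    d * divExact d f = f := by
  have h' : ∃ c, f = d * c := h
  rw [divExact, dif_pos h']
  exact h'.choose_spec.symm

theorem X_sub_X_ne_zero {i j : Fin N} (hij : i ≠ j) :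
    (X i - X j : MvPolynomial (Fin N) F) ≠ 0 :=
  sub_ne_zero.2 fun h => hij (X_injective h)

theorem Kswap_X_mul (i j k : Fin N) (f : MvPolynomial (Fin N) F) :
    Kswap i j (X k * f) = X (Equiv.swap i j k) * Kswap i j f := by
  simp [Kswap]

theorem Kswap_add (i j : Fin N) (f g : MvPolynomial (Fin N) F) :
    Kswap i j (f + g) = Kswap i j f + Kswap i j g := by
  simp [Kswap]

theorem Kswap_comm (i j : Fin N) (f : MvPolynomial (Fin N) F) : Kswap i j f = Kswap j i f := by
  rw [Kswap, Equiv.swap_comm, Kswap]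

theorem X_sub_X_dvd_sub_Kswap (i j : Fin N) (f : MvPolynomial (Fin N) F) :
    X i - X j ∣ f - Kswap i j f := by
  induction f using MvPolynomial.induction_on with
  | C a => simp [Kswap]
  | add p q hp hq =>
    rw [Kswap_add, add_sub_add_comm]
    exact dvd_add hp hq
  | mul_X p k hp =>
    rw [mul_comm p, Kswap_X_mul]
    have hX : (X i - X j : MvPolynomial (Fin N) F) ∣ X k - X (Equiv.swap i j k) := by
      by_cases hi : k = i
      · simp [hi]
      by_cases hj : k = j
      · subst hj
        rw [Equiv.swap_apply_right]
        exact (dvd_sub_comm).1 (dvd_refl _)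
      · simp [Equiv.swap_apply_of_ne_of_ne hi hj]
    have e : X k * p - X (Equiv.swap i j k) * Kswap i j p =
        (X k - X (Equiv.swap i j k)) * p + X (Equiv.swap i j k) * (p - Kswap i j p) := by ring
    rw [e]
    exact dvd_add (hX.mul_right _) (hp.mul_left _)

/-- The divided difference `(z_i - z_j)⁻¹ (1 - K_{ij})`. -/
noncomputable def dividedDiff (i j : Fin N) (f : MvPolynomial (Fin N) F) :
    MvPolynomial (Fin N) F :=
  divExact (X i - X j) (f - Kswap i j f)

theorem mul_dividedDiff (i j : Fin N) (f : MvPolynomial (Fin N) F) :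
    (X i - X j) * dividedDiff i j f = f - Kswap i j f :=
  mul_divExact (X_sub_X_dvd_sub_Kswap i j f)

theorem dividedDiff_eq {i j : Fin N} (hij : i ≠ j) {f g : MvPolynomial (Fin N) F}
    (h : (X i - X j) * g = f - Kswap i j f) : dividedDiff i j f = g :=
  mul_left_cancel₀ (X_sub_X_ne_zero hij) ((mul_dividedDiff i j f).trans h.symm)

theorem dividedDiff_add {i j : Fin N} (hij : i ≠ j) (f g : MvPolynomial (Fin N) F) :
    dividedDiff i j (f + g) = dividedDiff i j f + dividedDiff i j g := by
  apply dividedDiff_eq hij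
  rw [mul_add, mul_dividedDiff, mul_dividedDiff, Kswap_add]
  ring

theorem dividedDiff_smul {i j : Fin N} (hij : i ≠ j) (c : F) (f : MvPolynomial (Fin N) F) :
    dividedDiff i j (c • f) = c • dividedDiff i j f := by
  apply dividedDiff_eq hij
  rw [mul_smul_comm, mul_dividedDiff, smul_sub]
  simp [Kswap]

theorem dividedDiff_C {i j : Fin N} (hij : i ≠ j) (c : F) :
    dividedDiff i j (C c : MvPolynomial (Fin N) F) = 0 := by
  apply dividedDiff_eq hij
  simp [Kswap]

theorem dividedDiff_X_mul {i j : Fin N} (hij : i ≠ j) (k : Fin N) (f : MvPolynomial (Fin N) F) :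
    dividedDiff i j (X k * f) = X k * dividedDiff i j f +
      (if k = i then Kswap i j f else if k = j then - Kswap i j f else 0) := by
  apply dividedDiff_eq hij
  rw [Kswap_X_mul, mul_add, mul_left_comm, mul_dividedDiff]
  split_ifs with hi hj
  · subst hi
    rw [Equiv.swap_apply_left]
    ring
  · subst hj
    rw [Equiv.swap_apply_right]
    ring
  · rw [Equiv.swap_apply_of_ne_of_ne hi hj]
    ring

theorem rename_Kswap (σ : Equiv.Perm (Fin N)) (i j : Fin N) (f : MvPolynomial (Fin N) F) :
    rename σ (Kswap i j f) = Kswap (σ i) (σ j) (rename σ f) := by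
  simp only [Kswap, rename_rename]
  congr 2
  funext x
  simp [Equiv.swap_apply_apply]

theorem rename_dividedDiff (σ : Equiv.Perm (Fin N)) {i j : Fin N} (hij : i ≠ j)
    (f : MvPolynomial (Fin N) F) :
    rename σ (dividedDiff i j f) = dividedDiff (σ i) (σ j) (rename σ f) := by
  symm
  apply dividedDiff_eq (σ.injective.ne hij)
  rw [← rename_Kswap, ← map_sub, ← mul_dividedDiff]
  simp

theorem nabla_eq (β : F) (i : Fin N) (f : MvPolynomial (Fin N) F) :
    nabla β i f = pderiv i f + β • ∑ j ∈ univ.erase i, dividedDiff i j f := rfl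

theorem nabla_add (β : F) (i : Fin N) (f g : MvPolynomial (Fin N) F) :
    nabla β i (f + g) = nabla β i f + nabla β i g := by
  simp only [nabla_eq, map_add]
  rw [sum_congr rfl fun j hj => dividedDiff_add (ne_of_mem_erase hj).symm f g,
    sum_add_distrib, smul_add]
  abel

theorem nabla_smul (β : F) (i : Fin N) (c : F) (f : MvPolynomial (Fin N) F) :
    nabla β i (c • f) = c • nabla β i f := by
  simp only [nabla_eq, Derivation.map_smul]
  rw [sum_congr rfl fun j hj => dividedDiff_smul (ne_of_mem_erase hj).symm c f,
    ← smul_sum, smul_add, smul_comm]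

/-- The Dunkl operator as a linear map. -/
noncomputable def nablaLin (β : F) (i : Fin N) :
    MvPolynomial (Fin N) F →ₗ[F] MvPolynomial (Fin N) F where
  toFun := nabla β i
  map_add' := nabla_add β i
  map_smul' := nabla_smul β i

theorem nabla_zero (β : F) (i : Fin N) : nabla β i (0 : MvPolynomial (Fin N) F) = 0 :=
  map_zero (nablaLin β i)

theorem nabla_sub (β : F) (i : Fin N) (f g : MvPolynomial (Fin N) F) :
    nabla β i (f - g) = nabla β i f - nabla β i g :=
  map_sub (nablaLin β i) f g

theorem nabla_sum {ι : Type*} (β : F) (i : Fin N) (s : Finset ι)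
    (f : ι → MvPolynomial (Fin N) F) :
    nabla β i (∑ a ∈ s, f a) = ∑ a ∈ s, nabla β i (f a) :=
  map_sum (nablaLin β i) f s

theorem nabla_C (β : F) (i : Fin N) (c : F) :
    nabla β i (C c : MvPolynomial (Fin N) F) = 0 := by
  rw [nabla_eq, pderiv_C,
    sum_eq_zero fun j hj => dividedDiff_C (ne_of_mem_erase hj).symm c, smul_zero, add_zero]

theorem nabla_X_mul_of_ne (β : F) {i k : Fin N} (hik : i ≠ k) (f : MvPolynomial (Fin N) F) :
    nabla β i (X k * f) = X k * nabla β i f - β • Kswap i k f := by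
  rw [nabla_eq, nabla_eq,
    sum_congr rfl fun j hj => dividedDiff_X_mul (ne_of_mem_erase hj).symm k f]
  have hs : ∑ j ∈ univ.erase i,
      (if k = i then Kswap i j f else if k = j then - Kswap i j f else 0) = - Kswap i k f := by
    rw [sum_eq_single_of_mem k (mem_erase.2 ⟨hik.symm, mem_univ k⟩)]
    · simp [hik.symm]
    · intro j _ hjk
      simp [hik.symm, hjk.symm]
  rw [sum_add_distrib, hs, ← mul_sum, Derivation.leibniz, pderiv_X_of_ne hik.symm]
  simp only [smul_eq_C_mul, smul_eq_mul]
  ring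

theorem nabla_X_mul_self (β : F) (i : Fin N) (f : MvPolynomial (Fin N) F) :
    nabla β i (X i * f) =
      X i * nabla β i f + f + β • ∑ m ∈ univ.erase i, Kswap i m f := by
  rw [nabla_eq, nabla_eq,
    sum_congr rfl fun j hj => dividedDiff_X_mul (ne_of_mem_erase hj).symm i f]
  simp only [if_true]
  rw [sum_add_distrib, ← mul_sum, Derivation.leibniz, pderiv_X_self]
  simp only [smul_eq_C_mul, smul_eq_mul]
  ring

theorem rename_nabla (σ : Equiv.Perm (Fin N)) (β : F) (i : Fin N)
    (f : MvPolynomial (Fin N) F) :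
    rename σ (nabla β i f) = nabla β (σ i) (rename σ f) := by
  rw [nabla_eq, nabla_eq, map_add, map_smul, map_sum, pderiv_rename σ.injective,
    sum_congr rfl fun j hj => rename_dividedDiff σ (ne_of_mem_erase hj).symm f]
  congr 2
  refine sum_bij (fun j _ => σ j) ?_ ?_ ?_ ?_
  · simp
  · simp
  · intro b hb
    exact ⟨σ.symm b, by simpa [Equiv.symm_apply_eq] using hb, by simp⟩
  · simp

theorem Kswap_nabla (β : F) (a b i : Fin N) (f : MvPolynomial (Fin N) F) :
    Kswap a b (nabla β i f) = nabla β (Equiv.swap a b i) (Kswap a b f) :=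
  rename_nabla _ β i f

theorem nabla_comm_X_mul_self (β : F) {i j : Fin N} (hij : i ≠ j) (p : MvPolynomial (Fin N) F)
    (hp : nabla β i (nabla β j p) = nabla β j (nabla β i p)) :
    nabla β i (nabla β j (X i * p)) = nabla β j (nabla β i (X i * p)) := by
  rw [nabla_X_mul_of_ne β hij.symm, nabla_X_mul_self, nabla_sub, nabla_add, nabla_add,
    nabla_X_mul_self, nabla_X_mul_of_ne β hij.symm, nabla_smul, nabla_smul, nabla_sum, hp]
  have hj : j ∈ univ.erase i := mem_erase.2 ⟨hij.symm, mem_univ j⟩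
  rw [← add_sum_erase _ _ hj, ← add_sum_erase _ _ hj]
  have h : ∀ m ∈ (univ.erase i).erase j,
      Kswap i m (nabla β j p) = nabla β j (Kswap i m p) := by
    intro m hm
    rw [Kswap_nabla, Equiv.swap_apply_of_ne_of_ne hij.symm (ne_of_mem_erase hm).symm]
  rw [sum_congr rfl h, Kswap_nabla, Kswap_comm j i, Kswap_comm j i, Kswap_nabla,
    Equiv.swap_apply_right, Equiv.swap_apply_left]
  simp only [smul_eq_C_mul]
  ring

theorem nabla_comm (β : F) (i j : Fin N) (f : MvPolynomial (Fin N) F) :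
    nabla β i (nabla β j f) = nabla β j (nabla β i f) := by
  by_cases hij : i = j
  · rw [hij]
  induction f using MvPolynomial.induction_on with
  | C a => simp [nabla_C, nabla_zero]
  | add p q hp hq => simp [nabla_add, hp, hq]
  | mul_X p k hp =>
    rw [mul_comm p]
    by_cases hi : k = i
    · subst hi
      exact nabla_comm_X_mul_self β hij p hp
    by_cases hj : k = j
    · subst hj
      exact (nabla_comm_X_mul_self β (Ne.symm hij) p hp.symm).symm
    have hik : i ≠ k := Ne.symm hi
    have hjk : j ≠ k := Ne.symm hj
    rw [nabla_X_mul_of_ne β hik, nabla_X_mul_of_ne β hjk, nabla_sub, nabla_sub,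
      nabla_X_mul_of_ne β hik, nabla_X_mul_of_ne β hjk, nabla_smul, nabla_smul, Kswap_nabla,
      Kswap_nabla, Equiv.swap_apply_of_ne_of_ne (Ne.symm hij) hjk,
      Equiv.swap_apply_of_ne_of_ne hij hik, hp]
    ring

/-- The composite of the Dunkl operators indexed by a list, head first. -/
noncomputable def nablaList (β : F) (L : List (Fin N)) (f : MvPolynomial (Fin N) F) :
    MvPolynomial (Fin N) F :=
  L.foldl (fun g l => nabla β l g) f

theorem nablaList_cons (β : F) (l : Fin N) (L : List (Fin N)) (f : MvPolynomial (Fin N) F) :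
    nablaList β (l :: L) f = nablaList β L (nabla β l f) := rfl

theorem nablaList_perm (β : F) {L L' : List (Fin N)} (h : L.Perm L')
    (f : MvPolynomial (Fin N) F) : nablaList β L f = nablaList β L' f := by
  have : RightCommutative (fun (g : MvPolynomial (Fin N) F) l => nabla β l g) :=
    ⟨fun g a b => nabla_comm β b a g⟩
  exact h.foldl_eq f

theorem nablaList_zero (β : F) (L : List (Fin N)) :
    nablaList β L (0 : MvPolynomial (Fin N) F) = 0 := by
  induction L with
  | nil => rfl
  | cons l L ih => rw [nablaList_cons, nabla_zero, ih]

theorem nablaList_smul (β c : F) (L : List (Fin N)) (f : MvPolynomial (Fin N) F) :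
    nablaList β L (c • f) = c • nablaList β L f := by
  induction L generalizing f with
  | nil => rfl
  | cons l L ih => rw [nablaList_cons, nabla_smul, ih, nablaList_cons]

theorem nablaList_sum {ι : Type*} (β : F) (L : List (Fin N)) (s : Finset ι)
    (f : ι → MvPolynomial (Fin N) F) :
    nablaList β L (∑ a ∈ s, f a) = ∑ a ∈ s, nablaList β L (f a) := by
  induction L generalizing f with
  | nil => rfl
  | cons l L ih => simp only [nablaList_cons, nabla_sum, ih]

theorem rename_Dlist (σ : Equiv.Perm (Fin N)) (β : F) (k : ℕ) (L : List (Fin N))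
    (f : MvPolynomial (Fin N) F) :
    rename σ (Dlist β k L f) = Dlist β k (L.map σ) (rename σ f) := by
  induction L generalizing k with
  | nil => rfl
  | cons l L ih => simp [Dlist, Dop, rename_nabla, ih]

theorem Kswap_Dlist (β : F) (k : ℕ) {a b : Fin N} {L : List (Fin N)} (ha : a ∉ L) (hb : b ∉ L)
    {f : MvPolynomial (Fin N) F} (hf : Kswap a b f = f) :
    Kswap a b (Dlist β k L f) = Dlist β k L f := by
  have hL : L.map (Equiv.swap a b) = L := by
    refine (List.map_congr_left fun x hx => ?_).trans L.map_id
    exact Equiv.swap_apply_of_ne_of_ne (fun h => ha (h ▸ hx)) (fun h => hb (h ▸ hx))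
  rw [Kswap, rename_Dlist, hL]
  exact congrArg _ hf

theorem nabla_Dop (β : F) {l j : Fin N} (hlj : l ≠ j) {g : MvPolynomial (Fin N) F}
    (hg : Kswap l j g = g) :
    nabla β l (Dop β j g) = Dop β j (nabla β l g) - β • nabla β l g := by
  rw [Dop, nabla_X_mul_of_ne β hlj, Kswap_nabla, Equiv.swap_apply_right, hg, nabla_comm, Dop]

theorem Dop_add (β : F) (j : Fin N) (f g : MvPolynomial (Fin N) F) :
    Dop β j (f + g) = Dop β j f + Dop β j g := by
  simp only [Dop, nabla_add, mul_add]

theorem Dop_smul (β c : F) (j : Fin N) (f : MvPolynomial (Fin N) F) :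
    Dop β j (c • f) = c • Dop β j f := by
  simp only [Dop, nabla_smul, mul_smul_comm]

theorem Dlist_swap (β : F) (k : ℕ) {a b : Fin N} {L : List (Fin N)} (hab : a ≠ b)
    (ha : a ∉ L) (hb : b ∉ L) {f : MvPolynomial (Fin N) F} (hf : Kswap a b f = f) :
    Dlist β k (a :: b :: L) f = Dlist β k (b :: a :: L) f := by
  have hg := Kswap_Dlist β (k + 1 + 1) ha hb hf
  simp only [Dlist]
  generalize Dlist β (k + 1 + 1) L f = g at hg
  have hg' : Kswap b a g = g := by rw [Kswap_comm, hg]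
  have h₁ : Dop β a (Dop β b g) = X a * (X b * nabla β a (nabla β b g)) - β • Dop β a g := by
    rw [Dop, nabla_Dop β hab hg, nabla_comm]
    simp only [Dop, smul_eq_C_mul]
    rw [nabla_comm β b a]
    ring
  have h₂ : Dop β b (Dop β a g) = X a * (X b * nabla β a (nabla β b g)) - β • Dop β b g := by
    rw [Dop, nabla_Dop β hab.symm hg']
    simp only [Dop, smul_eq_C_mul]
    ring
  rw [Dop_add, Dop_add, Dop_smul, Dop_smul, h₁, h₂]
  simp only [smul_eq_C_mul, Nat.cast_add, Nat.cast_one, map_mul, map_add, map_one]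
  ring

theorem Dlist_perm (β : F) {L L' : List (Fin N)} (h : L.Perm L') (hL : L.Nodup)
    {f : MvPolynomial (Fin N) F} (hf : ∀ a b, Kswap a b f = f) (k : ℕ) :
    Dlist β k L f = Dlist β k L' f := by
  induction h generalizing k with
  | nil => rfl
  | cons x _ ih => simp only [Dlist, ih hL.of_cons]
  | swap x y l =>
    simp only [List.nodup_cons, List.mem_cons, not_or] at hL
    exact Dlist_swap β k hL.1.1 hL.1.2 hL.2.1 (hf y x)
  | trans h₁ _ ih₁ ih₂ => rw [ih₁ hL, ih₂ (h₁.nodup_iff.1 hL)]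

theorem nabla_Dlist_succ (β : F) (k : ℕ) {l : Fin N} {L : List (Fin N)} (hl : (l :: L).Nodup)
    {f : MvPolynomial (Fin N) F} (hf : ∀ j ∈ L, Kswap l j f = f) :
    nabla β l (Dlist β (k + 1) L f) = Dlist β k L (nabla β l f) := by
  induction L generalizing k with
  | nil => rfl
  | cons j L ih =>
    simp only [List.nodup_cons, List.mem_cons, not_or] at hl
    have ih' := ih (k + 1) (List.nodup_cons.2 ⟨hl.1.2, hl.2.2⟩)
      fun m hm => hf m (List.mem_cons_of_mem _ hm)
    have hg := Kswap_Dlist β (k + 1 + 1) hl.1.2 hl.2.1 (hf j List.mem_cons_self)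
    simp only [Dlist]
    rw [nabla_add, nabla_Dop β hl.1.1 hg, nabla_smul, ih']
    simp only [smul_eq_C_mul, Nat.cast_add, Nat.cast_one, map_mul, map_add, map_one]
    ring

theorem Dlist_zero_eq (β : F) {L : List (Fin N)} (hL : L.Nodup)
    {f : MvPolynomial (Fin N) F} (hf : ∀ a ∈ L, ∀ b ∈ L, Kswap a b f = f) :
    Dlist β 0 L f = (L.map X).prod * nablaList β L f := by
  induction L generalizing f with
  | nil => simp [Dlist, nablaList]
  | cons l L ih =>
    have hl := List.nodup_cons.1 hL
    have hne : ∀ a ∈ L, l ≠ a := fun a ha h => hl.1 (h ▸ ha)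
    have ih' := ih hl.2 (f := nabla β l f) fun a ha b hb => by
      rw [Kswap_nabla, Equiv.swap_apply_of_ne_of_ne (hne a ha) (hne b hb),
        hf a (List.mem_cons_of_mem _ ha) b (List.mem_cons_of_mem _ hb)]
    rw [Dlist, Dop, nabla_Dlist_succ β 0 hL
      fun j hj => hf l List.mem_cons_self j (List.mem_cons_of_mem _ hj), ih', nablaList_cons]
    simp [mul_assoc]

theorem rename_zJ (σ : Equiv.Perm (Fin N)) (J : Finset (Fin N)) :
    rename σ (zJ J : MvPolynomial (Fin N) F) = zJ (J.image σ) := by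
  simp [zJ, prod_image σ.injective.injOn]

theorem rename_DJ (σ : Equiv.Perm (Fin N)) (β : F) (k : ℕ) (J : Finset (Fin N))
    {f : MvPolynomial (Fin N) F} (hf : ∀ τ : Equiv.Perm (Fin N), rename τ f = f) :
    rename σ (DJ β k J f) = DJ β k (J.image σ) f := by
  rw [DJ, rename_Dlist, hf, DJ]
  have hn : ((J.sort (· ≤ ·)).map σ).Nodup := (J.sort_nodup _).map σ.injective
  refine Dlist_perm β ?_ hn (fun a b => hf _) k
  refine (List.perm_ext_iff_of_nodup hn (sort_nodup _ _)).2 fun x => ?_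
  simp

theorem image_swap_of_mem {l m : Fin N} {J : Finset (Fin N)} (hm : m ∈ J) (hl : l ∉ J) :
    J.image (Equiv.swap l m) = insert l (J.erase m) := by
  ext x
  simp only [mem_image, mem_insert, mem_erase]
  constructor
  · rintro ⟨y, hy, rfl⟩
    by_cases hym : y = m
    · simp [hym]
    · have hyl : y ≠ l := fun h => hl (h ▸ hy)
      rw [Equiv.swap_apply_of_ne_of_ne hyl hym]
      exact Or.inr ⟨hym, hy⟩
  · rintro (rfl | ⟨hxm, hx⟩)
    · exact ⟨m, hm, Equiv.swap_apply_right _ _⟩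
    · exact ⟨x, hx, Equiv.swap_apply_of_ne_of_ne (fun h => hl (h ▸ hx)) hxm⟩

theorem nabla_zJ_mul (β : F) {l : Fin N} {R : Finset (Fin N)} (hl : l ∉ R)
    (g : MvPolynomial (Fin N) F) :
    nabla β l (zJ R * g) =
      zJ R * nabla β l g - β • ∑ m ∈ R, zJ (R.erase m) * Kswap l m g := by
  induction R using Finset.induction_on with
  | empty => simp [zJ]
  | insert a R ha ih =>
    simp only [mem_insert, not_or] at hl
    have hz : ∀ S : Finset (Fin N), a ∉ S →
        (zJ (insert a S) : MvPolynomial (Fin N) F) = X a * zJ S := fun S hS => prod_insert hS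
    have hK : Kswap l a (zJ R * g) = zJ R * Kswap l a g := by
      rw [Kswap, map_mul, rename_zJ, Kswap]
      congr 2
      refine (image_congr fun x hx => ?_).trans image_id
      exact Equiv.swap_apply_of_ne_of_ne (fun h => hl.2 (h ▸ hx)) (fun h => ha (h ▸ hx))
    have hs : ∑ m ∈ R, zJ ((insert a R).erase m) * Kswap l m g =
        X a * ∑ m ∈ R, zJ (R.erase m) * Kswap l m g := by
      rw [mul_sum]
      refine sum_congr rfl fun m hm => ?_
      rw [erase_insert_of_ne (ne_of_mem_of_not_mem hm ha).symm,
        hz _ fun h => ha (mem_of_mem_erase h), mul_assoc]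
    rw [sum_insert ha, hs, erase_insert ha, hz R ha, mul_assoc, nabla_X_mul_of_ne β hl.1, ih hl.2,
      hK]
    simp only [smul_eq_C_mul]
    ring

theorem nablaList_zJ_mul_eq_zero (β : F) {i : ℕ} {h : Finset (Fin N) → MvPolynomial (Fin N) F}
    (hker : ∀ J : Finset (Fin N), J.card = i → ∀ l ∉ J, nabla β l (h J) = 0)
    (hswap : ∀ J : Finset (Fin N), ∀ m ∈ J, ∀ l ∉ J,
      Kswap l m (h J) = h (insert l (J.erase m)))
    (n : ℕ) {R Q : Finset (Fin N)} {L : List (Fin N)} (hRQ : Disjoint R Q) (hR : R.card = n)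
    (hi : (R ∪ Q).card = i) (hL : L.Nodup) (hn : n < (L.toFinset \ Q).card) :
    nablaList β L (zJ R * h (R ∪ Q)) = 0 := by
  induction n generalizing R Q L with
  | zero =>
    obtain ⟨l, hl⟩ := card_pos.1 hn
    rw [mem_sdiff, List.mem_toFinset] at hl
    rw [card_eq_zero] at hR
    subst hR
    rw [nablaList_perm β (List.perm_cons_erase hl.1), nablaList_cons]
    simp only [zJ, prod_empty, one_mul]
    rw [hker _ hi l (by simpa using hl.2), nablaList_zero]
  | succ n ih =>
    obtain ⟨l, hl, hlR⟩ := exists_mem_notMem_of_card_lt_card (hR.trans_lt hn)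
    rw [mem_sdiff, List.mem_toFinset] at hl
    have hlJ : l ∉ R ∪ Q := by simp [hlR, hl.2]
    rw [nablaList_perm β (List.perm_cons_erase hl.1), nablaList_cons, nabla_zJ_mul β hlR,
      hker _ hi l hlJ, mul_zero, zero_sub, ← neg_smul, nablaList_smul, nablaList_sum]
    rw [sum_eq_zero, smul_zero]
    intro m hm
    have hmQ : m ∉ Q := disjoint_left.1 hRQ hm
    have hset : insert l ((R ∪ Q).erase m) = R.erase m ∪ insert l Q := by
      rw [erase_union_distrib, erase_eq_of_notMem hmQ, union_insert]
    rw [hswap _ m (mem_union_left _ hm) l hlJ, hset]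
    apply ih
    · rw [disjoint_insert_right]
      exact ⟨fun h' => hlR (mem_of_mem_erase h'), hRQ.mono_left (erase_subset _ _)⟩
    · rw [card_erase_of_mem hm, hR, Nat.add_sub_cancel]
    · rw [← hset, card_insert_of_notMem fun h' => hlJ (mem_of_mem_erase h'),
        card_erase_add_one (mem_union_left _ hm), hi]
    · exact hL.erase l
    · have hsub : (L.erase l).toFinset \ insert l Q = (L.toFinset \ Q).erase l := by
        ext x
        simp only [mem_sdiff, List.mem_toFinset, mem_insert, mem_erase, hL.mem_erase_iff]
        tauto
      rw [hsub, card_erase_of_mem (by simpa using hl)]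
      omega

/-- Symmetric polynomials annihilated by every product of `i + 1` Dunkl operators with distinct
indices. -/
def DunklLengthLE (β : F) (i : ℕ) (f : MvPolynomial (Fin N) F) : Prop :=
  (∀ σ : Equiv.Perm (Fin N), rename σ f = f) ∧
    ∀ L : List (Fin N), L.Nodup → L.length = i + 1 → nablaList β L f = 0

theorem DunklLengthLE.succ {β : F} {i : ℕ} {f : MvPolynomial (Fin N) F}
    (hf : DunklLengthLE β i f) : DunklLengthLE β (i + 1) f := by
  refine ⟨hf.1, fun L hL hlen => ?_⟩
  match L, hL, hlen with
  | l :: L, hL, hlen =>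
    have hp : (l :: L).Perm (L ++ [l]) := (List.perm_append_singleton l L).symm
    rw [nablaList_perm β hp, nablaList, List.foldl_append]
    have h0 := hf.2 L hL.of_cons (by simpa using hlen)
    rw [nablaList] at h0
    simp [h0, nabla_zero]

theorem nabla_DJ_one_eq_zero {β : F} {i : ℕ} {f : MvPolynomial (Fin N) F}
    (hf : DunklLengthLE β i f) {J : Finset (Fin N)} (hJ : J.card = i) {l : Fin N} (hl : l ∉ J) :
    nabla β l (DJ β 1 J f) = 0 := by
  have hn : (l :: J.sort (· ≤ ·)).Nodup := List.nodup_cons.2 ⟨by simpa using hl, sort_nodup _ _⟩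
  have hne : ∀ a ∈ J.sort (· ≤ ·), l ≠ a := fun a ha h => hl (by simpa [h] using ha)
  rw [DJ, nabla_Dlist_succ β 0 hn fun j _ => hf.1 _, Dlist_zero_eq β (sort_nodup _ _),
    ← nablaList_cons, hf.2 _ hn (by simp [hJ]), mul_zero]
  intro a ha b hb
  rw [Kswap_nabla, Equiv.swap_apply_of_ne_of_ne (hne a ha) (hne b hb), Kswap, hf.1]

theorem DunklLengthLE.Bplus {β : F} {i : ℕ} {f : MvPolynomial (Fin N) F}
    (hf : DunklLengthLE β i f) : DunklLengthLE β i (Bplus β i univ f) := by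
  constructor
  · intro σ
    rw [_root_.Bplus, map_sum]
    refine sum_bij (fun J _ => J.image σ) ?_ ?_ ?_ ?_
    · intro J hJ
      rw [mem_powersetCard] at hJ ⊢
      exact ⟨subset_univ _, by rw [card_image_of_injective _ σ.injective, hJ.2]⟩
    · intro J _ J' _ h
      exact image_injective σ.injective h
    · intro J hJ
      rw [mem_powersetCard] at hJ
      refine ⟨J.image σ.symm, mem_powersetCard.2 ⟨subset_univ _, ?_⟩, ?_⟩
      · rw [card_image_of_injective _ σ.symm.injective, hJ.2]
      · simp [image_image]
    · intro J _
      rw [map_mul, rename_zJ, rename_DJ σ β 1 J hf.1]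
  · intro L hL hlen
    rw [_root_.Bplus, nablaList_sum]
    refine sum_eq_zero fun J hJ => ?_
    have hc := (mem_powersetCard.1 hJ).2
    have := nablaList_zJ_mul_eq_zero β (i := i) (h := fun J => DJ β 1 J f)
      (fun J hJ l hl => nabla_DJ_one_eq_zero hf hJ hl)
      (fun J m hm l hl => by
        rw [Kswap, rename_DJ _ β 1 J hf.1, image_swap_of_mem hm hl])
      i (R := J) (Q := ∅) (L := L) (disjoint_empty_right _) hc (by simpa using hc) hL
      (by rw [sdiff_empty, List.toFinset_card_of_nodup hL, hlen]; omega)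
    simpa using this

theorem dunklLengthLE_phiCS (β : F) (N : ℕ) (lam : ℕ → ℕ) (i : ℕ) :
    DunklLengthLE β i (phiCS β N lam i) := by
  induction i with
  | zero =>
    refine ⟨fun σ => by simp [phiCS], fun L _ hlen => ?_⟩
    obtain ⟨l, rfl⟩ := List.length_eq_one_iff.1 hlen
    exact nabla_C β l 1
  | succ i ih =>
    rw [phiCS]
    generalize lam i - lam (i + 1) = n
    induction n with
    | zero => exact ih.succ
    | succ n ihn =>
      rw [Function.iterate_succ_apply']
      exact ihn.Bplus

theorem phiCS_eq_of_le (β : F) (N : ℕ) {lam : ℕ → ℕ} {i m : ℕ}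
    (hzero : ∀ j, i ≤ j → lam j = 0) (him : i ≤ m) :
    phiCS β N lam m = phiCS β N lam i := by
  induction m, him using Nat.le_induction with
  | base => rfl
  | succ m hm ih => rw [phiCS, hzero m hm, Nat.zero_sub, Function.iterate_zero_apply, ih]

end DunklOperators

/-- `Ñ_{i+1,J} φ_λ = 0` for every `J ⊆ {1,…,N}` with `|J| = i+1`,
where `λ_{i+1} = … = λ_{N-1} = 0` (`lam` 0-indexed) and `Ñ_{ℓ,J} = D_{0,J}`. -/
theorem statement_6 {F : Type*} [Field F] [CharZero F] {N : ℕ} (β : F) (i : ℕ)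
    (hi1 : 1 ≤ i) (hiN : i ≤ N - 1)
    (lam : ℕ → ℕ) (hmono : ∀ a b : ℕ, a ≤ b → lam b ≤ lam a)
    (hzero : ∀ j, i ≤ j → lam j = 0)
    (J : Finset (Fin N)) (hJ : J.card = i + 1) :
    DJ β 0 J (phiCS β N lam (N - 1)) = 0 := by
  have hphi := dunklLengthLE_phiCS β N lam i
  rw [phiCS_eq_of_le β N hzero hiN, DJ, Dlist_zero_eq β (sort_nodup _ _) fun a _ b _ => hphi.1 _,
    hphi.2 _ (sort_nodup _ _) (by rw [length_sort, hJ]), mul_zero]
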